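/- arXiv:2305.13492 — 2 statements merged into one kernel-verified Lean document; each statement's English description precedes it below -/
import Mathlib

section
/- Let n ≥ 1, r > 0, w > 0, let F ⊆ [0, w)ⁿ ⊆ ℝⁿ be a finite set with N elements, and let S = F + (wℤ)ⁿ be its periodic extension. If for every p ∈ ℝⁿ there exists s ∈ S with dist(p, s) < 2r (the open balls of radius 2r centered at S cover ℝⁿ), then wⁿ ≤ N · vol(B(0, 2r)), where vol(B(0, 2r)) is the Lebesgue measure of the Euclidean ball of radius 2r in ℝⁿ. Equivalently, the packing density N · vol(B(0, r)) / wⁿ is at least 2⁻ⁿ. -/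
open MeasureTheory
open scoped ENNReal

/-- If the periodic extension `S = F + (wℤ)ⁿ` of a finite set `F` of `N`
points in the fundamental cell `[0,w)ⁿ` has the property that every point of `ℝⁿ` is
within distance `< 2r` of some point of `S`, then `wⁿ ≤ N ⬝ vol(B(0,2r))`; equivalently
the packing density `N ⬝ vol(B(0,r)) / wⁿ` is at least `2⁻ⁿ`. -/
theorem covering_implies_density_lower_bound
    (n : ℕ) (hn : 1 ≤ n) (r w : ℝ) (hr : 0 < r) (hw : 0 < w)
    (F : Finset (EuclideanSpace ℝ (Fin n)))
    (hF : ∀ x ∈ F, ∀ i, 0 ≤ x i ∧ x i < w)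
    (hcover : ∀ p : EuclideanSpace ℝ (Fin n), ∃ f ∈ F, ∃ v : Fin n → ℤ,
      dist p (f + (show EuclideanSpace ℝ (Fin n) from WithLp.toLp 2 fun i => w * (v i : ℝ))) < 2 * r) :
    ENNReal.ofReal (w ^ n)
      ≤ (F.card : ℝ≥0∞) * volume (Metric.ball (0 : EuclideanSpace ℝ (Fin n)) (2 * r))
    ∧ ((2 : ℝ≥0∞) ^ n)⁻¹
      ≤ (F.card : ℝ≥0∞) * volume (Metric.ball (0 : EuclideanSpace ℝ (Fin n)) r)
          / ENNReal.ofReal (w ^ n) := by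
  have h1 : ENNReal.ofReal (w ^ n)
      ≤ (F.card : ℝ≥0∞) * volume (Metric.ball (0 : EuclideanSpace ℝ (Fin n)) (2 * r)) := by
    let T : (Fin n → ℤ) → EuclideanSpace ℝ (Fin n) :=
      fun v => WithLp.toLp 2 fun i => w * (v i : ℝ)
    let C : Set (EuclideanSpace ℝ (Fin n)) :=
      WithLp.ofLp ⁻¹' (Set.univ.pi fun _ => Set.Ico (0 : ℝ) w)
    have hpi : MeasurableSet (Set.univ.pi fun _ : Fin n => Set.Ico (0 : ℝ) w) :=
      MeasurableSet.univ_pi fun _ => measurableSet_Ico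
    have hCm : MeasurableSet C := (PiLp.volume_preserving_ofLp (Fin n)).measurable hpi
    have hCv : volume C = ENNReal.ofReal (w ^ n) := by
      rw [(PiLp.volume_preserving_ofLp (Fin n)).measure_preimage hpi.nullMeasurableSet,
        Real.volume_pi_Ico]
      simp [ENNReal.ofReal_pow hw.le]
    have hC : ∀ x, x ∈ C ↔ ∀ i, 0 ≤ x i ∧ x i < w := by
      intro x; simp [C, Set.mem_pi]
    have hsub : C ⊆ ⋃ f ∈ F, ⋃ v, (C ∩ Metric.ball (f + T v) (2 * r)) := by
      intro p hp
      obtain ⟨f, hf, v, hv⟩ := hcover p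
      simp only [Set.mem_iUnion]
      exact ⟨f, hf, v, hp, hv⟩
    have hshift : ∀ f v, volume (C ∩ Metric.ball (f + T v) (2 * r))
        = volume (((fun x => x + T v) ⁻¹' C) ∩ Metric.ball f (2 * r)) := by
      intro f v
      rw [← measure_preimage_add_right volume (T v), Set.preimage_inter]
      congr 2
      ext x
      simp
    have hdisj : Pairwise (Function.onFun Disjoint fun v => (fun x => x + T v) ⁻¹' C) := by
      intro u v huv
      rw [Function.onFun, Set.disjoint_left]
      intro x hu hv
      apply huv
      funext i
      have a := (hC _).1 hu i
      have b := (hC _).1 hv i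
      simp only [T, PiLp.add_apply] at a b
      have c1 : w * ((u i : ℝ) - v i) < w * 1 := by linarith
      have c2 : w * ((v i : ℝ) - u i) < w * 1 := by linarith
      have d1 := lt_of_mul_lt_mul_left c1 hw.le
      have d2 := lt_of_mul_lt_mul_left c2 hw.le
      have e1 : u i - v i < 1 := by exact_mod_cast d1
      have e2 : v i - u i < 1 := by exact_mod_cast d2
      omega
    have hf : ∀ f, ∑' v, volume (C ∩ Metric.ball (f + T v) (2 * r))
        ≤ volume (Metric.ball (0 : EuclideanSpace ℝ (Fin n)) (2 * r)) := by
      intro f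
      simp_rw [hshift]
      rw [← measure_iUnion]
      · rw [← Measure.addHaar_ball_center volume f]
        exact measure_mono (Set.iUnion_subset fun v => Set.inter_subset_right)
      · intro u v huv
        exact (hdisj huv).mono Set.inter_subset_left Set.inter_subset_left
      · intro v
        exact ((measurable_add_const (T v)) hCm).inter measurableSet_ball
    rw [← hCv]
    calc volume C ≤ _ := measure_mono hsub
      _ ≤ ∑ f ∈ F, volume (⋃ v, (C ∩ Metric.ball (f + T v) (2 * r))) :=
        measure_biUnion_finset_le _ _
      _ ≤ ∑ f ∈ F, volume (Metric.ball (0 : EuclideanSpace ℝ (Fin n)) (2 * r)) :=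
        Finset.sum_le_sum fun f _ => (measure_iUnion_le _).trans (hf f)
      _ = _ := by simp
  refine ⟨h1, ?_⟩
  have h2 : volume (Metric.ball (0 : EuclideanSpace ℝ (Fin n)) (2 * r))
      = 2 ^ n * volume (Metric.ball (0 : EuclideanSpace ℝ (Fin n)) r) := by
    rw [Measure.addHaar_ball_mul_of_pos volume _ two_pos]
    simp [ENNReal.ofReal_pow]
  rw [h2] at h1
  have hw' : ENNReal.ofReal (w ^ n) ≠ 0 := by simp [hw]
  rw [ENNReal.le_div_iff_mul_le (Or.inl hw') (Or.inl ENNReal.ofReal_ne_top),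
    ENNReal.inv_mul_le_iff (by simp) (by simp)]
  calc _ ≤ _ := h1
    _ = _ := by ring
end

section
/- A point z ∈ ℝ⁴ satisfies ‖z − v‖₂ ≥ 1 for all v ∈ ℤ⁴ if and only if every coordinate of z lies in 1/2 + ℤ, i.e. z ∈ (1/2, 1/2, 1/2, 1/2) + ℤ⁴. Consequently the packing of two unit-diameter spheres in the unit 4-torus ℝ⁴/ℤ⁴ is unique: the two centers must differ by (1/2, 1/2, 1/2, 1/2) modulo ℤ⁴. -/
theorem norm_aux (z : EuclideanSpace ℝ (Fin 4)) (v : Fin 4 → ℤ) :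
    1 ≤ ‖z - (show EuclideanSpace ℝ (Fin 4) from WithLp.toLp 2 fun i => (v i : ℝ))‖ ↔
    1 ≤ ∑ i, (z i - v i) ^ 2 := by
  rw [EuclideanSpace.norm_eq, Real.one_le_sqrt]
  simp [Real.norm_eq_abs, sq_abs]

theorem round_aux (x : ℝ) : (x - round x) ^ 2 ≤ 1 / 4 := by
  have h := abs_le.1 (abs_sub_round x)
  nlinarith [h.1, h.2]

/-- A point `z ∈ ℝ⁴` is at Euclidean distance at least `1` from every
integer vector if and only if each of its coordinates lies in `1/2 + ℤ`; hence the
packing of two unit-diameter spheres in the unit `4`-torus is unique. -/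
theorem deep_holes_of_Z4 (z : EuclideanSpace ℝ (Fin 4)) :
    (∀ v : Fin 4 → ℤ,
      1 ≤ ‖z - (show EuclideanSpace ℝ (Fin 4) from WithLp.toLp 2 fun i => (v i : ℝ))‖)
    ↔ (∀ i, ∃ m : ℤ, z i = 1 / 2 + m) := by
  simp only [norm_aux]
  constructor
  · intro h i
    have h1 := h (fun i => round (z i))
    have key : (z i - round (z i)) ^ 2 = 1 / 4 := by
      rw [Fin.sum_univ_four] at h1
      have h0 := round_aux (z 0)
      have h2 := round_aux (z 1)
      have h3 := round_aux (z 2)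
      have h4 := round_aux (z 3)
      apply le_antisymm (round_aux _)
      fin_cases i <;> simp only [Fin.zero_eta, Fin.mk_one, Fin.reduceFinMk] <;> linarith
    have hp : (z i - round (z i) - 1 / 2) * (z i - round (z i) + 1 / 2) = 0 := by
      linarith
    rcases mul_eq_zero.1 hp with h | h
    · exact ⟨round (z i), by linarith⟩
    · exact ⟨round (z i) - 1, by push_cast; linarith⟩
  · intro h v
    have key : ∀ i, 1 / 4 ≤ (z i - v i) ^ 2 := by
      intro i
      obtain ⟨m, hm⟩ := h i
      rw [hm]
      have : (0 : ℝ) ≤ ((m - v i : ℤ) : ℝ) * ((m - v i + 1 : ℤ) : ℝ) := by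
        have : 0 ≤ (m - v i) * (m - v i + 1) := by
          rcases le_or_gt 0 (m - v i) with h | h
          · exact mul_nonneg h (by omega)
          · exact mul_nonneg_of_nonpos_of_nonpos (by omega) (by omega)
        exact_mod_cast this
      push_cast at this
      nlinarith
    rw [Fin.sum_univ_four]
    linarith [key 0, key 1, key 2, key 3]
end
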